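/- Fix an integer q ≥ 1 and scalings K_n ≤ P_n (positive integers) with K_n²/P_n → 0 as n → ∞. Let S_i, S_j, S_t be three independent uniformly random K_n-element subsets of a key pool of size P_n. Then for all sufficiently large n and every u ∈ {0, 1, …, K_n}, the conditional probability P[ |S_t ∩ S_i| ≥ q and |S_t ∩ S_j| ≥ q | |S_i ∩ S_j| = u ] is at most p_{s,q}(n)·u/K_n + (q+2)!·p_{s,q}(n)^{(q+1)/q}, where p_{s,q}(n) = 1 − Σ_{u'=0}^{q−1} [C(K_n,u')·C(P_n−K_n,K_n−u')/C(P_n,K_n)]. -/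

import Mathlib

open Finset Filter

/-- A configuration of three key rings `(S_i, S_j, S_t)`. -/
abbrev TripleConfig (P : ℕ) : Type :=
  Finset (Fin P) × Finset (Fin P) × Finset (Fin P)

/-- Weight of a single key ring: uniform over the `K`-element subsets. -/
noncomputable def ringWeight (K P : ℕ) (S : Finset (Fin P)) : ℝ :=
  if S.card = K then ((P.choose K : ℝ))⁻¹ else 0

/-- Probability weight of a triple of independent uniform key rings. -/
noncomputable def tweight (K P : ℕ) (ω : TripleConfig P) : ℝ :=
  ringWeight K P ω.1 * ringWeight K P ω.2.1 * ringWeight K P ω.2.2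

/-- Probability of an event for three independent uniform key rings. -/
noncomputable def tprob (K P : ℕ) (E : Set (TripleConfig P)) : ℝ :=
  ∑ ω : TripleConfig P, Set.indicator E (tweight K P) ω

/-- Conditional probability. -/
noncomputable def tcondProb (K P : ℕ) (A B : Set (TripleConfig P)) : ℝ :=
  tprob K P (A ∩ B) / tprob K P B

/-- `p_{s,q}`: the probability that two key rings share at least `q` keys. -/
noncomputable def psq (q K P : ℕ) : ℝ :=
  1 - ∑ u ∈ Finset.range q,
    ((K.choose u : ℝ) * ((P - K).choose (K - u) : ℝ)) / (P.choose K : ℝ)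

/-- `choose_mul` in ratio form. -/
lemma choose_sub_div_choose {P K m : ℕ} (hm : m ≤ K) (hKP : K ≤ P) :
    ((P - m).choose (K - m) : ℝ) / P.choose K = K.choose m / P.choose m := by
  have h1 : (P.choose K : ℝ) ≠ 0 := by exact_mod_cast (Nat.choose_pos hKP).ne'
  have h2 : (P.choose m : ℝ) ≠ 0 := by exact_mod_cast (Nat.choose_pos (hm.trans hKP)).ne'
  rw [div_eq_div_iff h1 h2]
  have := Nat.choose_mul (n := P) hm
  have h : ((P.choose K * K.choose m : ℕ) : ℝ) = (P.choose m * (P - m).choose (K - m) : ℕ) := by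
    rw [this]
  push_cast at h
  linarith

lemma ringWeight_nonneg (K P : ℕ) (S : Finset (Fin P)) : 0 ≤ ringWeight K P S := by
  unfold ringWeight
  split_ifs <;> positivity

/-- The probability that a key ring contains a given set of keys. -/
lemma sum_ringWeight_superset {K P : ℕ} (hKP : K ≤ P) (Q : Finset (Fin P)) :
    ∑ T, (if Q ⊆ T then ringWeight K P T else 0) = (K.choose #Q : ℝ) / P.choose #Q := by
  have h : ∑ T, (if Q ⊆ T then ringWeight K P T else 0)
      = #((powersetCard K (univ : Finset (Fin P))).filter (Q ⊆ ·)) * (P.choose K : ℝ)⁻¹ := by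
    rw [← nsmul_eq_mul, ← sum_const, sum_filter, powersetCard_eq_filter, sum_filter, powerset_univ]
    refine sum_congr rfl fun T _ => ?_
    unfold ringWeight
    split_ifs <;> rfl
  rw [h]
  rcases le_or_gt #Q K with hQ | hQ
  · rw [card_filter_powersetCard_subset _ _ _ (subset_univ _) hQ, card_univ, Fintype.card_fin,
      ← div_eq_mul_inv, choose_sub_div_choose hQ hKP]
  · rw [Nat.choose_eq_zero_of_lt hQ, filter_false_of_mem]
    · simp
    · intro T hT hQT
      have := card_le_card hQT
      rw [(mem_powersetCard.mp hT).2] at this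
      omega

lemma sum_ringWeight {K P : ℕ} (hKP : K ≤ P) : ∑ T, ringWeight K P T = 1 := by
  simpa using sum_ringWeight_superset hKP ∅

/-- Union bound for a key ring meeting both `A` and `B` in at least `q` keys. -/
lemma sum_ringWeight_inter_le {K P : ℕ} (hKP : K ≤ P) (q : ℕ) (A B : Finset (Fin P)) :
    ∑ T, (if q ≤ #(T ∩ A) ∧ q ≤ #(T ∩ B) then ringWeight K P T else 0)
      ≤ (#(A ∩ B)).choose q * ((K.choose q : ℝ) / P.choose q)
        + (#A).choose q * (#B * ((K.choose (q + 1) : ℝ) / P.choose (q + 1))) := by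
  have pointwise : ∀ T : Finset (Fin P),
      (if q ≤ #(T ∩ A) ∧ q ≤ #(T ∩ B) then ringWeight K P T else 0)
        ≤ ∑ Q ∈ powersetCard q (A ∩ B), (if Q ⊆ T then ringWeight K P T else 0)
          + ∑ Q ∈ powersetCard q A, ∑ b ∈ B \ A,
              (if insert b Q ⊆ T then ringWeight K P T else 0) := by
    intro T
    have nonneg (p : Prop) [Decidable p] : 0 ≤ (if p then ringWeight K P T else 0) := by
      split_ifs
      · exact ringWeight_nonneg K P T
      · exact le_rfl
    have h1 : 0 ≤ ∑ Q ∈ powersetCard q (A ∩ B), (if Q ⊆ T then ringWeight K P T else 0) :=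
      sum_nonneg fun _ _ => nonneg _
    have h2 (Q : Finset (Fin P)) :
        0 ≤ ∑ b ∈ B \ A, (if insert b Q ⊆ T then ringWeight K P T else 0) :=
      sum_nonneg fun _ _ => nonneg _
    have h3 : 0 ≤ ∑ Q ∈ powersetCard q A, ∑ b ∈ B \ A,
        (if insert b Q ⊆ T then ringWeight K P T else 0) := sum_nonneg fun _ _ => h2 _
    split_ifs with hT
    swap
    · positivity
    by_cases hAB : q ≤ #(T ∩ (A ∩ B))
    · obtain ⟨Q, hQ, hQc⟩ := exists_subset_card_eq hAB
      have hQT : Q ⊆ T := hQ.trans inter_subset_left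
      have := single_le_sum (f := fun Q => if Q ⊆ T then ringWeight K P T else 0)
        (fun _ _ => nonneg _) (mem_powersetCard.mpr ⟨hQ.trans inter_subset_right, hQc⟩)
      simp only [hQT, if_true] at this
      linarith
    · obtain ⟨Q, hQ, hQc⟩ := exists_subset_card_eq hT.1
      have hQT : Q ⊆ T := hQ.trans inter_subset_left
      obtain ⟨b, hb, hbA⟩ : ∃ b ∈ T ∩ B, b ∉ A := by
        by_contra! hcon
        refine hAB (hT.2.trans (card_le_card fun b hb => ?_))
        have := hcon b hb
        simp only [mem_inter] at hb ⊢
        tauto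
      rw [mem_inter] at hb
      have hbQ : insert b Q ⊆ T := insert_subset hb.1 hQT
      have e1 := single_le_sum (f := fun Q => ∑ b ∈ B \ A,
          (if insert b Q ⊆ T then ringWeight K P T else 0))
        (fun _ _ => h2 _) (mem_powersetCard.mpr ⟨hQ.trans inter_subset_right, hQc⟩)
      have e2 := single_le_sum (f := fun b => if insert b Q ⊆ T then ringWeight K P T else 0)
        (fun _ _ => nonneg _) (mem_sdiff.mpr ⟨hb.2, hbA⟩)
      simp only [hbQ, if_true] at e1 e2
      linarith
  refine (sum_le_sum fun T _ => pointwise T).trans ?_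
  rw [sum_add_distrib, sum_comm, sum_comm (t := powersetCard q A)]
  refine add_le_add (le_of_eq ?_) ?_
  · rw [sum_congr rfl fun Q hQ => by
      rw [sum_ringWeight_superset hKP, (mem_powersetCard.mp hQ).2]]
    simp
  · have inner : ∀ Q ∈ powersetCard q A,
        ∑ T, ∑ b ∈ B \ A, (if insert b Q ⊆ T then ringWeight K P T else 0)
          ≤ #B * ((K.choose (q + 1) : ℝ) / P.choose (q + 1)) := by
      intro Q hQ
      rw [mem_powersetCard] at hQ
      rw [sum_comm, sum_congr rfl fun b hb => by
        rw [sum_ringWeight_superset hKP,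
          card_insert_of_notMem fun h => (mem_sdiff.mp hb).2 (hQ.1 h), hQ.2]]
      rw [sum_const, nsmul_eq_mul]
      gcongr
      exact sdiff_subset
    refine (sum_le_sum inner).trans_eq ?_
    simp

/-- A bound on the third key ring, uniform over the first two, bounds the conditional
probability. -/
lemma tcondProb_le {K P : ℕ} (hKP : K ≤ P) (u : ℕ)
    (R : Finset (Fin P) → Finset (Fin P) → Finset (Fin P) → Prop)
    [∀ A B T, Decidable (R A B T)] {c : ℝ} (hc : 0 ≤ c)
    (h : ∀ A B : Finset (Fin P), #A = K → #B = K → #(A ∩ B) = u →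
      ∑ T, (if R A B T then ringWeight K P T else 0) ≤ c) :
    tcondProb K P {ω | R ω.1 ω.2.1 ω.2.2} {ω | #(ω.1 ∩ ω.2.1) = u} ≤ c := by
  have w := ringWeight_nonneg K P
  refine div_le_of_le_mul₀ (sum_nonneg fun ω _ => Set.indicator_nonneg (fun ω _ => ?_) _) hc ?_
  · exact mul_nonneg (mul_nonneg (w _) (w _)) (w _)
  unfold tprob
  simp only [Fintype.sum_prod_type, mul_sum]
  refine sum_le_sum fun A _ => sum_le_sum fun B _ => ?_
  rw [← mul_sum]
  by_cases hAB : #(A ∩ B) = u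
  swap
  · simp [Set.indicator, hAB]
  have e1 : ∑ T, Set.indicator ({ω : TripleConfig P | R ω.1 ω.2.1 ω.2.2} ∩
      {ω | #(ω.1 ∩ ω.2.1) = u}) (tweight K P) (A, B, T)
      = ringWeight K P A * ringWeight K P B * ∑ T, (if R A B T then ringWeight K P T else 0) := by
    rw [mul_sum]
    refine sum_congr rfl fun T _ => ?_
    by_cases hR : R A B T <;> simp [Set.indicator, hAB, hR, tweight]
  have e2 : ∑ T, Set.indicator {ω : TripleConfig P | #(ω.1 ∩ ω.2.1) = u} (tweight K P) (A, B, T)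
      = ringWeight K P A * ringWeight K P B := by
    rw [← mul_one (ringWeight K P A * ringWeight K P B), ← sum_ringWeight hKP, mul_sum]
    refine sum_congr rfl fun T _ => ?_
    simp [Set.indicator, hAB, tweight]
  rw [e1, e2, mul_comm c]
  by_cases hA : #A = K
  swap
  · simp [ringWeight, hA]
  by_cases hB : #B = K
  swap
  · simp [ringWeight, hB]
  exact mul_le_mul_of_nonneg_left (h A B hA hB hAB) (mul_nonneg (w _) (w _))

/-- Binomial moments of the hypergeometric distribution. -/
lemma sum_choose_mul_hypergeometric {K P : ℕ} (hKP : K ≤ P) (m : ℕ) :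
    ∑ v ∈ range (K + 1),
        (v.choose m : ℝ) * (((K.choose v : ℝ) * ((P - K).choose (K - v) : ℝ)) / (P.choose K : ℝ))
      = K.choose m * ((K.choose m : ℝ) / P.choose m) := by
  rcases lt_or_ge K m with hm | hm
  · rw [Nat.choose_eq_zero_of_lt hm]
    refine (sum_eq_zero fun v hv => ?_).trans (by simp)
    rw [Nat.choose_eq_zero_of_lt (by rw [mem_range] at hv; omega)]
    simp
  have count : ∑ v ∈ range (K + 1), v.choose m * (K.choose v * (P - K).choose (K - v))
      = K.choose m * (P - m).choose (K - m) := by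
    have hsplit : P - m = (K - m) + (P - K) := by omega
    rw [hsplit, Nat.add_choose_eq, Nat.sum_antidiagonal_eq_sum_range_succ_mk, mul_sum,
      show K + 1 = m + (K - m).succ by omega, sum_range_add, sum_eq_zero, zero_add]
    · refine sum_congr rfl fun i _ => ?_
      have := Nat.choose_mul (n := K) (Nat.le_add_right m i)
      rw [Nat.add_sub_cancel_left] at this
      rw [Nat.sub_add_eq, ← mul_assoc, mul_comm ((m + i).choose m), this, mul_assoc]
    · intro v hv
      rw [Nat.choose_eq_zero_of_lt (mem_range.mp hv), zero_mul]
  rw [← choose_sub_div_choose hm hKP, ← mul_div_assoc]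
  simp only [← mul_div_assoc]
  rw [← sum_div]
  congr 1
  exact_mod_cast count

/-- Second Bonferroni inequality for `q`-subsets. -/
lemma choose_le_one_add_mul_choose_succ {q : ℕ} (hq : 1 ≤ q) (x : ℕ) :
    x.choose q ≤ 1 + q * x.choose (q + 1) := by
  rcases le_or_gt x q with hx | hx
  · rcases hx.eq_or_lt with rfl | hx
    · simp
    · simp [Nat.choose_eq_zero_of_lt hx]
  obtain ⟨d, rfl⟩ := Nat.exists_eq_add_of_lt hx
  have h := Nat.choose_succ_right_eq (q + d + 1) q
  rw [show q + d + 1 - q = d + 1 by omega] at h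
  rcases Nat.eq_zero_or_pos d with rfl | hd
  · simp
  · have : (q + d + 1).choose q * (q + 1) ≤ (q * (q + d + 1).choose (q + 1)) * (q + 1) := by
      rw [mul_assoc, h, mul_left_comm]
      refine Nat.mul_le_mul_left _ ?_
      nlinarith
    exact (Nat.le_of_mul_le_mul_right this (by omega)).trans (Nat.le_add_left _ _)

lemma psq_lower_bound {q K P : ℕ} (hq : 1 ≤ q) (hKP : K ≤ P) :
    K.choose q * ((K.choose q : ℝ) / P.choose q)
        - q * (K.choose (q + 1) * ((K.choose (q + 1) : ℝ) / P.choose (q + 1))) ≤ psq q K P := by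
  rw [← sum_choose_mul_hypergeometric hKP, ← sum_choose_mul_hypergeometric hKP]
  have total := sum_choose_mul_hypergeometric hKP 0
  simp only [Nat.choose_zero_right, Nat.cast_one, one_mul, div_one] at total
  unfold psq
  set h : ℕ → ℝ := fun v => ((K.choose v : ℝ) * ((P - K).choose (K - v) : ℝ)) / (P.choose K : ℝ)
    with hdef
  have hnn : ∀ v, 0 ≤ h v := fun v => by positivity
  have low : ∑ v ∈ range q, h v ≤ ∑ v ∈ range (K + 1), if v < q then h v else 0 := by
    rw [← sum_filter, ← sum_filter_of_ne (p := (· ≤ K)) (s := range q)]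
    · refine sum_le_sum_of_subset_of_nonneg (fun v => ?_) fun v _ _ => hnn v
      simp only [mem_filter, mem_range]
      omega
    · intro v _ hv0
      by_contra! hcon
      exact hv0 (by simp [hdef, Nat.choose_eq_zero_of_lt hcon])
  have main : ∑ v ∈ range (K + 1), (v.choose q : ℝ) * h v
      ≤ ∑ v ∈ range (K + 1),
        ((h v - if v < q then h v else 0) + q * ((v.choose (q + 1) : ℝ) * h v)) := by
    refine sum_le_sum fun v _ => ?_
    split_ifs with hv
    · simp [Nat.choose_eq_zero_of_lt hv, Nat.choose_eq_zero_of_lt (hv.trans (Nat.lt_succ_self q))]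
    · have := choose_le_one_add_mul_choose_succ hq v
      have : (v.choose q : ℝ) ≤ 1 + q * v.choose (q + 1) := by exact_mod_cast this
      nlinarith [mul_le_mul_of_nonneg_right this (hnn v)]
  rw [sum_add_distrib, sum_sub_distrib, ← mul_sum] at main
  linarith

/-- Ratios of consecutive containment probabilities. -/
lemma choose_succ_div_le {q K P : ℕ} (hKP : K ≤ P) (hP : 0 < P) :
    (K.choose (q + 1) : ℝ) / P.choose (q + 1) ≤ (K.choose q : ℝ) / P.choose q * (K / P) := by
  rcases le_or_gt K q with hK | hK
  · rw [Nat.choose_eq_zero_of_lt (by omega)]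
    simp only [Nat.cast_zero, zero_div]
    positivity
  have hKs : (K.choose (q + 1) : ℝ) * (q + 1) = K.choose q * (K - q) := by
    rw [← Nat.cast_sub hK.le]
    exact_mod_cast Nat.choose_succ_right_eq K q
  have hPs : (P.choose (q + 1) : ℝ) * (q + 1) = P.choose q * (P - q) := by
    rw [← Nat.cast_sub (hK.le.trans hKP)]
    exact_mod_cast Nat.choose_succ_right_eq P q
  have hP' : (0 : ℝ) < P := by exact_mod_cast hP
  have hKPr : (K : ℝ) ≤ P := by exact_mod_cast hKP
  have hKq : (q : ℝ) < K := by exact_mod_cast hK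
  have hsub : (0 : ℝ) < P - q := by linarith
  rw [← mul_div_mul_right _ _ (show ((q : ℝ) + 1) ≠ 0 by positivity), hKs, hPs, mul_div_mul_comm]
  refine mul_le_mul_of_nonneg_left ?_ (by positivity)
  rw [div_le_div_iff₀ hsub hP']
  nlinarith [(Nat.cast_nonneg q : (0 : ℝ) ≤ q)]

lemma pow_le_choose_mul_choose_div {q K P : ℕ} (hq : 1 ≤ q) (hqK : q ≤ K) (hKP : K ≤ P) :
    ((K : ℝ) ^ 2 / P / q ^ 3) ^ q ≤ K.choose q * ((K.choose q : ℝ) / P.choose q) := by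
  have hq0 : (0 : ℝ) < q := by exact_mod_cast hq
  have hP0 : (0 : ℝ) < P := by exact_mod_cast (hq.trans hqK).trans hKP
  have hPq : (0 : ℝ) < P.choose q := by exact_mod_cast Nat.choose_pos (hqK.trans hKP)
  have hf : (0 : ℝ) < q.factorial := by exact_mod_cast q.factorial_pos
  have lin : (K : ℝ) / q ≤ (K + 1 - q : ℕ) := by
    rw [Nat.cast_sub (by omega), div_le_iff₀ hq0]
    have h1 : (1 : ℝ) ≤ q := by exact_mod_cast hq
    have h2 : (q : ℝ) ≤ K := by exact_mod_cast hqK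
    push_cast
    nlinarith [mul_nonneg (sub_nonneg.mpr h1) (sub_nonneg.mpr h2)]
  have lowK : ((K : ℝ) / q) ^ q / q.factorial ≤ K.choose q :=
    (by gcongr : ((K : ℝ) / q) ^ q / q.factorial
      ≤ ((K + 1 - q : ℕ) : ℝ) ^ q / q.factorial).trans (Nat.pow_le_choose q K)
  have upP : (P.choose q : ℝ) ≤ (P : ℝ) ^ q / q.factorial := Nat.choose_le_pow_div q P
  have fact : (q.factorial : ℝ) ≤ (q : ℝ) ^ q := by exact_mod_cast Nat.factorial_le_pow q
  calc ((K : ℝ) ^ 2 / P / q ^ 3) ^ q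
      = ((K : ℝ) / q) ^ q * (((K : ℝ) / q) ^ q / (P : ℝ) ^ q) / (q : ℝ) ^ q := by
        rw [← div_pow, ← mul_pow, ← div_pow]
        congr 1
        field_simp
    _ ≤ ((K : ℝ) / q) ^ q * (((K : ℝ) / q) ^ q / (P : ℝ) ^ q) / q.factorial := by gcongr
    _ = (((K : ℝ) / q) ^ q / q.factorial) *
          ((((K : ℝ) / q) ^ q / q.factorial) / ((P : ℝ) ^ q / q.factorial)) := by
        field_simp
    _ ≤ _ := by gcongr

lemma three_mul_cube_le_factorial {q : ℕ} (hq : 1 ≤ q) : 3 * q ^ 3 ≤ (q + 2).factorial := by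
  rcases hq.eq_or_lt with rfl | hq
  · decide
  rcases (Nat.succ_le_of_lt hq).eq_or_lt with rfl | hq
  · decide
  obtain ⟨k, rfl⟩ : ∃ k, q = k + 3 := ⟨q - 3, by omega⟩
  have := Nat.self_le_factorial (k + 2)
  rw [Nat.factorial_succ, Nat.factorial_succ, Nat.factorial_succ (k + 2)]
  calc 3 * (k + 3) ^ 3 ≤ 3 * (k + 3) ^ 3 + (k + 3) * (k ^ 3 + 8 * k ^ 2 + 20 * k + 13) :=
        Nat.le_add_right _ _
    _ = (k + 5) * ((k + 4) * ((k + 3) * (k + 2))) := by ring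
    _ ≤ (k + 5) * ((k + 4) * ((k + 3) * (k + 2).factorial)) := by gcongr

/-- Two key rings sharing `u` keys: the conditional bound for fixed parameters. -/
lemma tcondProb_le_of_sq_div_le {q K P u : ℕ} (hq : 1 ≤ q) (hK : 1 ≤ K) (hKP : K ≤ P)
    (hx : (K : ℝ) ^ 2 / P ≤ 1 / 16) (hu : u ≤ K) :
    tcondProb K P
        {ω | q ≤ (ω.2.2 ∩ ω.1).card ∧ q ≤ (ω.2.2 ∩ ω.2.1).card}
        {ω | (ω.1 ∩ ω.2.1).card = u}
      ≤ psq q K P * (u : ℝ) / (K : ℝ)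
          + (Nat.factorial (q + 2) : ℝ) * psq q K P ^ (((q : ℝ) + 1) / (q : ℝ)) := by
  have hq0 : (0 : ℝ) < q := by exact_mod_cast hq
  have hK0 : (0 : ℝ) < K := by exact_mod_cast hK
  have huK : (u : ℝ) / K ≤ 1 := (div_le_one hK0).mpr (by exact_mod_cast hu)
  have hbound := tcondProb_le hKP u (fun A B T => q ≤ #(T ∩ A) ∧ q ≤ #(T ∩ B))
    (c := u.choose q * ((K.choose q : ℝ) / P.choose q)
        + K.choose q * (K * ((K.choose (q + 1) : ℝ) / P.choose (q + 1)))) (by positivity)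
    (fun A B hA hB hAB => by
      have := sum_ringWeight_inter_le hKP q A B
      rwa [hA, hB, hAB] at this)
  refine hbound.trans ?_
  have hpow := pow_le_choose_mul_choose_div (q := q) (K := K) (P := P) hq
  have hp := psq_lower_bound hq hKP
  have hr := choose_succ_div_le (q := q) hKP (hK.trans hKP)
  set x : ℝ := (K : ℝ) ^ 2 / P with hxdef
  set p := psq q K P
  set r : ℝ := (K.choose q : ℝ) / P.choose q
  set r' : ℝ := (K.choose (q + 1) : ℝ) / P.choose (q + 1)
  set E : ℝ := K.choose q * r with hE
  have hr0 : 0 ≤ r := by positivity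
  have hr'0 : 0 ≤ r' := by positivity
  have hE0 : 0 ≤ E := by positivity
  have hx0 : 0 ≤ x := by positivity
  have hKr : K.choose q * (K * r') ≤ x * E := by
    calc (K.choose q : ℝ) * (K * r') ≤ K.choose q * (K * (r * (K / P))) := by gcongr
      _ = x * E := by rw [hE, hxdef]; ring
  have hmarked : (u.choose q : ℝ) * r ≤ u / K * E := by
    have h : u.choose q * K ≤ K.choose q * u := by
      obtain ⟨k, rfl⟩ := Nat.exists_eq_add_of_le' hq
      rcases Nat.eq_zero_or_pos u with rfl | hu0
      · simp
      obtain ⟨v, rfl⟩ := Nat.exists_eq_add_of_le' hu0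
      obtain ⟨L, rfl⟩ := Nat.exists_eq_add_of_le' hK
      have e1 := Nat.add_one_mul_choose_eq v k
      have e2 := Nat.add_one_mul_choose_eq L k
      have hm : v.choose k ≤ L.choose k := Nat.choose_le_choose k (by omega)
      refine Nat.le_of_mul_le_mul_right (c := k + 1) ?_ (by omega)
      calc (v + 1).choose (k + 1) * (L + 1) * (k + 1)
          = (v + 1).choose (k + 1) * (k + 1) * (L + 1) := by ring
        _ = (v + 1) * v.choose k * (L + 1) := by rw [e1]
        _ ≤ (v + 1) * L.choose k * (L + 1) := by gcongr
        _ = (L + 1) * L.choose k * (v + 1) := by ring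
        _ = (L + 1).choose (k + 1) * (v + 1) * (k + 1) := by rw [e2]; ring
    have h : (u.choose q : ℝ) * K ≤ K.choose q * u := by exact_mod_cast h
    calc (u.choose q : ℝ) * r ≤ (K.choose q * u / K) * r := by
          gcongr
          rwa [le_div_iff₀ hK0]
      _ = u / K * E := by rw [hE]; ring
  have hmoment : q * (K.choose (q + 1) * r') ≤ x * E := by
    have h : (K.choose (q + 1) : ℝ) * q ≤ K.choose q * K := by
      have := Nat.choose_succ_right_eq K q
      have h : K.choose (q + 1) * q ≤ K.choose q * K :=
        calc K.choose (q + 1) * q ≤ K.choose (q + 1) * (q + 1) := by gcongr; omega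
          _ = K.choose q * (K - q) := this
          _ ≤ K.choose q * K := by gcongr; omega
      exact_mod_cast h
    calc q * (K.choose (q + 1) * r') = (K.choose (q + 1) : ℝ) * q * r' := by ring
      _ ≤ K.choose q * K * r' := by gcongr
      _ = K.choose q * (K * r') := by ring
      _ ≤ x * E := hKr
  have hEp : E - x * E ≤ p := by linarith
  have hxE : x * E ≤ 1 / 16 * E := by gcongr
  have hp0 : 0 ≤ p := by linarith
  have hlead : u / K * E ≤ p * u / K + x * E := by
    calc u / K * E ≤ u / K * (p + x * E) := by gcongr; linarith
      _ = p * u / K + u / K * (x * E) := by ring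
      _ ≤ p * u / K + 1 * (x * E) := by gcongr
      _ = _ := by rw [one_mul]
  suffices herr : 2 * (x * E) ≤ ((q + 2).factorial : ℝ) * p ^ (((q : ℝ) + 1) / q) by linarith
  rcases lt_or_ge K q with hKq | hqK
  · have : E = 0 := by rw [hE, Nat.choose_eq_zero_of_lt hKq]; simp
    rw [this, mul_zero, mul_zero]
    positivity
  have hroot : 15 / 16 * (x / q ^ 3) ≤ p ^ ((1 : ℝ) / q) := by
    rw [one_div, Real.le_rpow_inv_iff_of_pos (by positivity) hp0 hq0, Real.rpow_natCast, mul_pow]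
    calc (15 / 16 : ℝ) ^ q * (x / q ^ 3) ^ q ≤ 15 / 16 * E := by
          gcongr
          · exact pow_le_of_le_one (by norm_num) (by norm_num) (by omega)
          · exact hpow hqK hKP
      _ ≤ p := by linarith
  have hfact : (3 : ℝ) * q ^ 3 ≤ (q + 2).factorial := by
    exact_mod_cast three_mul_cube_le_factorial hq
  have hsplit : p ^ (((q : ℝ) + 1) / q) = p * p ^ ((1 : ℝ) / q) := by
    rw [add_div, div_self hq0.ne', Real.rpow_one_add' hp0 (by positivity)]
  rw [hsplit]
  calc 2 * (x * E) ≤ 2 * (x * (16 / 15 * p)) := by gcongr; linarith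
    _ ≤ 3 * (p * (15 / 16 * x)) := by nlinarith [mul_nonneg hx0 hp0]
    _ = (3 * q ^ 3) * (p * (15 / 16 * (x / q ^ 3))) := by field_simp
    _ ≤ _ := by gcongr

/-- if `K_n²/P_n → 0`, then for all sufficiently large `n` and
every `u ∈ {0, …, K_n}`, for three independent uniform `K_n`-subsets
`S_i = ω.1`, `S_j = ω.2.1`, `S_t = ω.2.2`,
`P[|S_t∩S_i| ≥ q ∧ |S_t∩S_j| ≥ q ∣ |S_i∩S_j| = u]
  ≤ p_{s,q} u/K_n + (q+2)!·p_{s,q}^{(q+1)/q}`. -/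
theorem two_shared_keyrings_conditional_prob_bound
    (q : ℕ) (hq : 1 ≤ q)
    (K P : ℕ → ℕ)
    (hK1 : ∀ n, 1 ≤ K n) (hKP : ∀ n, K n ≤ P n)
    (hKsqP : Tendsto (fun n => ((K n : ℝ)) ^ 2 / (P n : ℝ)) atTop (nhds 0)) :
    ∀ᶠ (n : ℕ) in atTop, ∀ u : ℕ, u ≤ K n →
      tcondProb (K n) (P n)
          {ω | q ≤ (ω.2.2 ∩ ω.1).card ∧ q ≤ (ω.2.2 ∩ ω.2.1).card}
          {ω | (ω.1 ∩ ω.2.1).card = u}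
        ≤ psq q (K n) (P n) * (u : ℝ) / (K n : ℝ)
            + (Nat.factorial (q + 2) : ℝ) *
                psq q (K n) (P n) ^ (((q : ℝ) + 1) / (q : ℝ)) := by
  filter_upwards [hKsqP.eventually_le_const (show (0 : ℝ) < 1 / 16 by norm_num)] with n hn u hu
  exact tcondProb_le_of_sq_div_le hq (hK1 n) (hKP n) hn hu
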